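/- The function F_S : ℍ → ℂ defined by F_S(y) := f_∞(y) − f₀(−1/(3y)) extends to a holomorphic function on the cut plane ℂ ∖ ℝ_{≤0}; that is, there exists a function G : ℂ → ℂ that is complex-differentiable on ℂ ∖ ℝ_{≤0} and satisfies G(y) = f_∞(y) − f₀(−1/(3y)) for every y with Im(y) > 0. -/

import Mathlib

open scoped Real

noncomputable section

/-- The nonprincipal Dirichlet character modulo 3. -/
def chi (n : ℤ) : ℤ := if n % 3 = 1 then 1 else if n % 3 = 2 then -1 else 0

/-- The weak-coupling Stokes constants of local ℙ². -/
def S (n : ℕ) : ℂ := 3 * Real.sqrt 3 * Complex.I * ∑ d ∈ n.divisors, (chi d : ℂ) / d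

/-- The strong-coupling Stokes constants of local ℙ². -/
def R (n : ℕ) : ℂ := 3 * ∑ d ∈ n.divisors, (chi d : ℂ) * d / n

/-- The generating function of the weak-coupling Stokes constants on the upper half-plane. -/
def f0 (y : ℂ) : ℂ := ∑' n : ℕ, S (n + 1) * Complex.exp (2 * π * Complex.I * (n + 1) * y)

/-- The generating function of the strong-coupling Stokes constants on the upper half-plane. -/
def finf (y : ℂ) : ℂ := ∑' n : ℕ, R (n + 1) * Complex.exp (2 * π * Complex.I * (n + 1) * y)

open Complex Filter Topology

theorem norm_chi_le_one (n : ℤ) : ‖(chi n : ℂ)‖ ≤ 1 := by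
  unfold chi
  split_ifs <;> simp

/-- Grouping a sum twisted by `chi` along residue classes modulo 3. -/
theorem hasSum_residue_pairs {D : ℕ → ℂ} {a : ℂ} (h : HasSum (fun d : ℕ ↦ (chi d : ℂ) * D d) a) :
    HasSum (fun k : ℕ ↦ D (3 * k + 1) - D (3 * k + 2)) a := by
  have h1 := ((Nat.divModEquiv 3).symm.hasSum_iff.mpr h).prod_fiberwise
    (fun k ↦ hasSum_fintype _)
  convert h1 using 2 with k
  have h0 : chi (k * 3) = 0 := by unfold chi; lia
  have h1 : chi (k * 3 + 1) = 1 := by unfold chi; lia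
  have h2 : chi (k * 3 + 2) = -1 := by unfold chi; lia
  simp [Nat.divModEquiv, Fin.sum_univ_three, h0, h1, h2, mul_comm 3, sub_eq_add_neg]

theorem summable_and_tsum_divisorsAntidiagonal {a : ℕ → ℕ → ℂ} (ha : ∀ d m, ‖a d m‖ ≤ 1) {q : ℂ}
    (hq : ‖q‖ < 1) :
    Summable (fun c : ℕ+ × ℕ+ ↦ a c.1 c.2 * q ^ (c.1 * c.2 : ℕ)) ∧
    ∑' n : ℕ+, (∑ x ∈ (n : ℕ).divisorsAntidiagonal, a x.1 x.2) * q ^ (n : ℕ) =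
      ∑' c : ℕ+ × ℕ+, a c.1 c.2 * q ^ (c.1 * c.2 : ℕ) := by
  have hs : Summable (fun c : ℕ+ × ℕ+ ↦ a c.1 c.2 * q ^ (c.1 * c.2 : ℕ)) := by
    have h0 := summable_prod_mul_pow 0 hq
    refine Summable.of_norm_bounded h0.norm fun c ↦ ?_
    simp only [norm_mul, pow_zero, norm_one]
    gcongr
    exact ha _ _
  refine ⟨hs, ?_⟩
  have hs' := sigmaAntidiagonalEquivProd.summable_iff.mpr hs
  rw [← sigmaAntidiagonalEquivProd.tsum_eq]
  refine Eq.trans ?_ (Summable.tsum_sigma hs').symm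
  refine tsum_congr fun n ↦ ?_
  simp only [Function.comp_def, sigmaAntidiagonalEquivProd, divisorsAntidiagonalFactors, PNat.mk_coe,
    Equiv.coe_fn_mk, tsum_fintype, Finset.univ_eq_attach]
  rw [(n : ℕ).divisorsAntidiagonal.sum_attach fun x : ℕ × ℕ ↦ a x.1 x.2 * q ^ (x.1 * x.2),
    Finset.sum_mul]
  refine Finset.sum_congr rfl fun x hx ↦ ?_
  rw [(Nat.mem_divisorsAntidiagonal.mp hx).1]

theorem summable_inv_mul_add_sq :
    Summable fun p : ℕ × ℕ ↦
      1 / (((p.1 : ℝ) + 1) * ((p.1 : ℝ) + 1 + ((p.2 : ℝ) + 1)) ^ 2) := by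
  have h : Summable fun n : ℕ ↦ 1 / ((n : ℝ) + 1) ^ (3 / 2 : ℝ) := by
    have := (Real.summable_one_div_nat_rpow (p := 3 / 2)).mpr (by norm_num)
    simpa using (summable_nat_add_iff 1).mpr this
  refine (h.mul_of_nonneg h (fun _ ↦ by positivity) (fun _ ↦ by positivity)).of_nonneg_of_le
    (fun p ↦ by positivity) fun p ↦ ?_
  rw [div_mul_div_comm, one_mul]
  have hM : (0 : ℝ) < (p.1 : ℝ) + 1 := by positivity
  have hK : (0 : ℝ) < (p.2 : ℝ) + 1 := by positivity
  generalize (p.1 : ℝ) + 1 = M at *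
  generalize (p.2 : ℝ) + 1 = K at *
  refine one_div_le_one_div_of_le (by positivity) ?_
  calc M ^ (3 / 2 : ℝ) * K ^ (3 / 2 : ℝ)
      = M * (M ^ (1 / 2 : ℝ) * K ^ (3 / 2 : ℝ)) := by
        rw [show (3 / 2 : ℝ) = 1 + 1 / 2 by norm_num, Real.rpow_add hM, Real.rpow_one]; ring
    _ ≤ M * ((M + K) ^ (1 / 2 : ℝ) * (M + K) ^ (3 / 2 : ℝ)) := by
        gcongr <;> linarith
    _ = M * (M + K) ^ 2 := by
        rw [← Real.rpow_add (by positivity), ← Real.rpow_natCast]; norm_num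

theorem exists_le_norm_add_mul {K : Set ℂ} (hK : IsCompact K) (hK' : K ⊆ slitPlane) :
    ∃ c > 0, ∀ w ∈ K, ∀ s t : ℝ, 0 ≤ s → 0 ≤ t → c * (s + t) ≤ ‖s + t * w‖ := by
  rcases K.eq_empty_or_nonempty with rfl | hne
  · exact ⟨1, one_pos, by simp⟩
  obtain ⟨p, hp, hmin⟩ := ((isCompact_Icc (a := (0 : ℝ)) (b := 1)).prod hK).exists_isMinOn
    ((Set.nonempty_Icc.mpr zero_le_one).prod hne)
    (f := fun p : ℝ × ℂ ↦ ‖((1 - p.1 : ℝ) : ℂ) + p.1 * p.2‖) (by fun_prop)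
  refine ⟨‖((1 - p.1 : ℝ) : ℂ) + p.1 * p.2‖, ?_, fun w hw s t hs ht ↦ ?_⟩
  rotate_left
  · rcases (add_nonneg hs ht).eq_or_lt with h | h
    · rw [← h]; simp
    have h1 := hmin (Set.mk_mem_prod (show t / (s + t) ∈ Set.Icc (0 : ℝ) 1 from
      ⟨by positivity, by rw [div_le_one h]; linarith⟩) hw)
    simp only [Set.mem_ofPred_eq] at h1
    have h2 : (s + t * w : ℂ) = ((s + t : ℝ) : ℂ) *
        (((1 - t / (s + t) : ℝ) : ℂ) + (t / (s + t) : ℝ) * w) := by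
      have : ((s : ℂ) + t) ≠ 0 := by exact_mod_cast h.ne'
      push_cast
      field_simp
      ring
    rw [h2, norm_mul, norm_real, Real.norm_of_nonneg h.le, mul_comm]
    gcongr
  · rw [gt_iff_lt, norm_pos_iff]
    intro h0
    obtain ⟨⟨hp0, hp1⟩, hp2⟩ := hp
    have hre := congrArg re h0
    have him := congrArg im h0
    simp at hre him
    rcases him with h | h
    · simp [h] at hre
    · rcases mem_slitPlane_iff.mp (hK' hp2) with h' | h'
      · nlinarith [mul_nonneg hp0 h'.le]
      · exact h' h

/-- The general term of the double series representing the holomorphic extension. -/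
def pairTerm (w : ℂ) (p : ℕ × ℕ) : ℂ :=
  1 / (p.1 + 1) *
    (1 / (3 * p.2 + 1 + 3 * (p.1 + 1) * w) - 1 / (3 * p.2 + 2 + 3 * (p.1 + 1) * w))

theorem add_mul_ne_zero_of_mem_slitPlane {w : ℂ} (hw : w ∈ slitPlane) {s t : ℝ} (hs : 0 < s)
    (ht : 0 ≤ t) : (s + t * w : ℂ) ≠ 0 := by
  obtain ⟨c, hc, h⟩ := exists_le_norm_add_mul isCompact_singleton
    (Set.singleton_subset_iff.mpr hw)
  have := h w rfl s t hs.le ht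
  exact norm_pos_iff.mp (lt_of_lt_of_le (by positivity) this)

theorem exists_norm_pairTerm_le {K : Set ℂ} (hK : IsCompact K) (hK' : K ⊆ slitPlane) :
    ∃ C : ℝ, ∀ w ∈ K, ∀ p : ℕ × ℕ, ‖pairTerm w p‖ ≤
      C * (1 / (((p.1 : ℝ) + 1) * ((p.1 : ℝ) + 1 + ((p.2 : ℝ) + 1)) ^ 2)) := by
  obtain ⟨c, hc, h⟩ := exists_le_norm_add_mul hK hK'
  refine ⟨1 / c ^ 2, fun w hw p ↦ ?_⟩
  have h1 := h w hw (3 * p.2 + 1) (3 * (p.1 + 1)) (by positivity) (by positivity)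
  have h2 := h w hw (3 * p.2 + 2) (3 * (p.1 + 1)) (by positivity) (by positivity)
  push_cast at h1 h2
  have hpos : 0 < c * ((p.1 : ℝ) + 1 + ((p.2 : ℝ) + 1)) := by positivity
  have g1 : c * ((p.1 : ℝ) + 1 + ((p.2 : ℝ) + 1)) ≤ ‖(3 * p.2 + 1 + 3 * (p.1 + 1) * w : ℂ)‖ := by
    refine (mul_le_mul_of_nonneg_left ?_ hc.le).trans h1
    linarith [(Nat.cast_nonneg p.1 : (0 : ℝ) ≤ p.1), (Nat.cast_nonneg p.2 : (0 : ℝ) ≤ p.2)]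
  have g2 : c * ((p.1 : ℝ) + 1 + ((p.2 : ℝ) + 1)) ≤ ‖(3 * p.2 + 2 + 3 * (p.1 + 1) * w : ℂ)‖ := by
    refine (mul_le_mul_of_nonneg_left ?_ hc.le).trans h2
    linarith [(Nat.cast_nonneg p.1 : (0 : ℝ) ≤ p.1), (Nat.cast_nonneg p.2 : (0 : ℝ) ≤ p.2)]
  have n1 := norm_pos_iff.mp (hpos.trans_le g1)
  have n2 := norm_pos_iff.mp (hpos.trans_le g2)
  have e : pairTerm w p = 1 / ((((p.1 + 1 : ℕ) : ℂ)) *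
      ((3 * p.2 + 1 + 3 * (p.1 + 1) * w) * (3 * p.2 + 2 + 3 * (p.1 + 1) * w))) := by
    have : (p.1 + 1 : ℂ) ≠ 0 := by exact_mod_cast p.1.succ_ne_zero
    rw [pairTerm, div_sub_div _ _ n1 n2, div_mul_div_comm]
    push_cast
    congr 1
    ring
  have e' : 1 / c ^ 2 * (1 / (((p.1 : ℝ) + 1) * ((p.1 : ℝ) + 1 + ((p.2 : ℝ) + 1)) ^ 2)) =
      1 / (((p.1 + 1 : ℕ) : ℝ) * ((c * ((p.1 : ℝ) + 1 + ((p.2 : ℝ) + 1))) *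
        (c * ((p.1 : ℝ) + 1 + ((p.2 : ℝ) + 1))))) := by
    push_cast
    field_simp
  rw [e, e', norm_div, norm_one, norm_mul, norm_mul, Complex.norm_natCast]
  gcongr

theorem summable_pairTerm {w : ℂ} (hw : w ∈ slitPlane) : Summable (pairTerm w) := by
  obtain ⟨C, hC⟩ := exists_norm_pairTerm_le isCompact_singleton (Set.singleton_subset_iff.mpr hw)
  exact Summable.of_norm_bounded (summable_inv_mul_add_sq.mul_left C) (hC w rfl)

theorem differentiableOn_tsum_pairTerm :
    DifferentiableOn ℂ (fun w ↦ ∑' p, pairTerm w p) slitPlane := by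
  intro w hw
  obtain ⟨ε, hε, hb⟩ := Metric.nhds_basis_closedBall.mem_iff.mp (isOpen_slitPlane.mem_nhds hw)
  obtain ⟨C, hC⟩ := exists_norm_pairTerm_le (isCompact_closedBall w ε) hb
  have := differentiableOn_tsum_of_summable_norm (F := fun p w ↦ pairTerm w p)
    (summable_inv_mul_add_sq.mul_left C) (U := Metric.ball w ε) (fun p v hv ↦ ?_)
    Metric.isOpen_ball fun p v hv ↦ hC v (Metric.ball_subset_closedBall hv) p
  · exact (this.differentiableAt (Metric.ball_mem_nhds w hε)).differentiableWithinAt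
  · have hv' := hb (Metric.ball_subset_closedBall hv)
    have h1 := add_mul_ne_zero_of_mem_slitPlane hv' (s := 3 * p.2 + 1) (t := 3 * (p.1 + 1))
      (by positivity) (by positivity)
    have h2 := add_mul_ne_zero_of_mem_slitPlane hv' (s := 3 * p.2 + 2) (t := 3 * (p.1 + 1))
      (by positivity) (by positivity)
    push_cast at h1 h2
    unfold pairTerm
    fun_prop (disch := assumption)

theorem norm_exp_two_pi_I_mul_lt_one {z : ℂ} (hz : 0 < z.im) : ‖exp (2 * π * I * z)‖ < 1 := by
  simpa using UpperHalfPlane.norm_exp_two_pi_I_lt_one ⟨z, hz⟩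

theorem hasSum_nat_iff_hasSum_pnat {f : ℕ → ℂ} (h0 : f 0 = 0) {a : ℂ} :
    HasSum (fun n : ℕ+ ↦ f n) a ↔ HasSum f a :=
  PNat.coe_injective.hasSum_iff fun n hn ↦ by
    rcases n.eq_zero_or_pos with rfl | hn'
    · exact h0
    · exact absurd ⟨⟨n, hn'⟩, rfl⟩ hn

theorem f0_eq_tsum_pairs {y : ℂ} (hy : 0 < y.im) {H : ℕ → ℂ}
    (hH : ∀ d : ℕ+, H d = 1 / d * ∑' m : ℕ+, exp (2 * π * I * y) ^ (d * m : ℕ)) :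
    f0 y = 3 * Real.sqrt 3 * I * ∑' k : ℕ, (H (3 * k + 1) - H (3 * k + 2)) := by
  have hq := norm_exp_two_pi_I_mul_lt_one hy
  set q := exp (2 * π * I * y) with hq_def
  obtain ⟨hs, he⟩ := summable_and_tsum_divisorsAntidiagonal (a := fun d _ ↦ (chi d : ℂ) / d)
    (fun d m ↦ by
      rw [norm_div]
      rcases d.eq_zero_or_pos with rfl | hd
      · simp
      · exact div_le_one_of_le₀ ((norm_chi_le_one d).trans (by simpa using! hd)) (by positivity)) hq
  have h1 : f0 y = 3 * Real.sqrt 3 * I *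
      ∑' n : ℕ+, (∑ x ∈ (n : ℕ).divisorsAntidiagonal, (chi x.1 : ℂ) / x.1) * q ^ (n : ℕ) := by
    rw [tsum_pnat_eq_tsum_succ (f := fun n : ℕ ↦
      (∑ x ∈ n.divisorsAntidiagonal, (chi x.1 : ℂ) / x.1) * q ^ n), f0, ← tsum_mul_left]
    refine tsum_congr fun n ↦ ?_
    rw [Nat.sum_divisorsAntidiagonal (fun d _ ↦ (chi d : ℂ) / d), S, hq_def, ← exp_nat_mul]
    push_cast
    ring_nf
  rw [h1, he]
  congr 1
  refine (hasSum_residue_pairs ((hasSum_nat_iff_hasSum_pnat (by simp [chi])).mp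
    (hs.hasSum.prod_fiberwise fun d ↦ ?_))).tsum_eq.symm
  have := (hs.prod_factor d).hasSum
  convert! this using 1
  rw [hH]
  simp only [tsum_mul_left]
  ring

theorem finf_eq_tsum_pairs {y : ℂ} (hy : 0 < y.im) :
    finf y = 3 * ∑' m : ℕ, 1 / ((m : ℂ) + 1) * ∑' k : ℕ,
      (exp (2 * π * I * ((m + 1) * y)) ^ (3 * k + 1) -
        exp (2 * π * I * ((m + 1) * y)) ^ (3 * k + 2)) := by
  have hq := norm_exp_two_pi_I_mul_lt_one hy
  have hexp (m : ℕ) : exp (2 * π * I * ((m + 1) * y)) = exp (2 * π * I * y) ^ (m + 1) := by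
    rw [← exp_nat_mul]
    push_cast
    ring_nf
  simp only [hexp]
  set q := exp (2 * π * I * y) with hq_def
  obtain ⟨hs, he⟩ := summable_and_tsum_divisorsAntidiagonal (a := fun m d ↦ (chi d : ℂ) / m)
    (fun m d ↦ by
      rw [norm_div]
      rcases m.eq_zero_or_pos with rfl | hd
      · simp
      · exact div_le_one_of_le₀ ((norm_chi_le_one d).trans (by simpa using! hd)) (by positivity)) hq
  have h1 : finf y = 3 *
      ∑' n : ℕ+, (∑ x ∈ (n : ℕ).divisorsAntidiagonal, (chi x.2 : ℂ) / x.1) * q ^ (n : ℕ) := by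
    rw [tsum_pnat_eq_tsum_succ (f := fun n : ℕ ↦
      (∑ x ∈ n.divisorsAntidiagonal, (chi x.2 : ℂ) / x.1) * q ^ n), finf, ← tsum_mul_left]
    refine tsum_congr fun n ↦ ?_
    rw [Nat.sum_divisorsAntidiagonal' (fun m d ↦ (chi d : ℂ) / m), R, hq_def, ← exp_nat_mul,
      mul_assoc]
    congr 2
    · refine Finset.sum_congr rfl fun d hd ↦ ?_
      have hd0 : (d : ℂ) ≠ 0 := by exact_mod_cast (Nat.pos_of_mem_divisors hd).ne'
      rw [Nat.cast_div (Nat.dvd_of_mem_divisors hd) hd0, div_div_eq_mul_div]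
    · push_cast
      ring_nf
  rw [h1, he, hs.tsum_prod]
  congr 1
  rw [tsum_pnat_eq_tsum_succ (f := fun m : ℕ ↦ ∑' d : ℕ+, (chi d : ℂ) / m * q ^ (m * d : ℕ))]
  refine tsum_congr fun m ↦ ?_
  have h2 := (hs.prod_factor m.succPNat).hasSum
  rw [← tsum_mul_left]
  refine Eq.symm (HasSum.tsum_eq ?_)
  convert! hasSum_residue_pairs (D := fun d ↦ 1 / ((m : ℂ) + 1) * q ^ ((m + 1) * d))
    (a := ∑' d : ℕ+, (chi d : ℂ) / (m + 1 : ℕ) * q ^ ((m + 1) * d : ℕ))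
    ((hasSum_nat_iff_hasSum_pnat (by simp [chi])).mp ?_) using 1
  · ext k
    rw [← pow_mul, ← pow_mul]
    ring
  · convert! h2 using 1
    ext d
    simp
    ring

theorem tsum_pow_eq_cot {z : ℂ} (hz : 0 < z.im) :
    ∑' m : ℕ+, exp (2 * π * I * z) ^ (m : ℕ) =
      -1 / 2 + I / (2 * π) * (1 / z + ∑' n : ℕ, cotTerm z n) := by
  have h1 := pi_mul_cot_pi_q_exp ⟨z, hz⟩
  have h2 := cot_series_rep' (UpperHalfPlane.coe_mem_integerComplement ⟨z, hz⟩)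
  have hs := summable_geometric_of_norm_lt_one (norm_exp_two_pi_I_mul_lt_one hz)
  rw [← tsum_zero_pnat_eq_tsum_nat hs] at h1
  simp only [pow_zero] at h1
  have hπ : (π : ℂ) ≠ 0 := by exact_mod_cast Real.pi_ne_zero
  change _ - _ = ∑' n : ℕ, cotTerm z n at h2
  rw [← h2]
  simp only [] at h1 ⊢
  rw [h1]
  field_simp
  linear_combination
    (π + 2 * π * ∑' m : ℕ+, exp (2 * π * I * z) ^ (m : ℕ)) * I_sq

theorem exp_two_pi_I_div_three : exp (2 * π * I * (1 / 3)) = -1 / 2 + Real.sqrt 3 / 2 * I := by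
  rw [show (2 * π * I * (1 / 3) : ℂ) = ((π - π / 3 : ℝ) : ℂ) * I by push_cast; ring,
    exp_mul_I, ← ofReal_cos, ← ofReal_sin, Real.cos_pi_sub, Real.sin_pi_sub,
    Real.cos_pi_div_three, Real.sin_pi_div_three]
  push_cast
  ring

theorem tendsto_one_div_three_mul_add (a : ℂ) :
    Tendsto (fun N : ℕ ↦ 1 / (3 * (N : ℂ) + a)) atTop (𝓝 0) := by
  simp only [one_div]
  refine tendsto_inv₀_cobounded.comp ?_
  rw [← tendsto_norm_atTop_iff_cobounded]
  refine tendsto_atTop_mono (f := fun N : ℕ ↦ (N : ℝ) - ‖a‖) (fun N ↦ ?_)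
    (tendsto_atTop_add_const_right _ _ tendsto_natCast_atTop_atTop)
  have := norm_sub_norm_le (3 * (N : ℂ)) (-a)
  simp at this
  linarith [(Nat.cast_nonneg N : (0 : ℝ) ≤ N)]

theorem sum_cotTerm_sub_cotTerm {w : ℂ} {P : ℕ → ℂ}
    (hP : ∀ d : ℕ, P d = 1 / (d - 3 * w) + 1 / (d + 3 * w)) (N : ℕ) :
    ∑ n ∈ Finset.range N, cotTerm (w - 1 / 3) n + 1 / (w - 1 / 3) -
      (∑ n ∈ Finset.range N, cotTerm (w + 1 / 3) n + 1 / (w + 1 / 3)) =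
    -3 * ∑ n ∈ Finset.range N, (P (3 * n + 1) - P (3 * n + 2)) - 3 * P (3 * N + 1) := by
  have key (d : ℕ) (e : ℂ) (hd : 3 * e = d) : 1 / (w - e) = -3 * (1 / (d - 3 * w)) := by
    rw [← hd, ← mul_sub, ← neg_sub e w, one_div, one_div, mul_inv, inv_neg]
    ring
  have key' (d : ℕ) (e : ℂ) (hd : 3 * e = d) : 1 / (w + e) = 3 * (1 / (d + 3 * w)) := by
    rw [← hd, ← mul_add, add_comm e, one_div, one_div, mul_inv]
    ring
  induction N with
  | zero =>
    simp only [Finset.range_zero, Finset.sum_empty, hP]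
    rw [key 1 _ (by norm_num), key' 1 _ (by norm_num)]
    push_cast
    ring
  | succ N ih =>
    simp only [Finset.sum_range_succ]
    have h1 : cotTerm (w - 1 / 3) N = 3 * (1 / ((3 * N + 2 : ℕ) + 3 * w)) -
        3 * (1 / ((3 * N + 4 : ℕ) - 3 * w)) := by
      have e1 := key (3 * N + 4) (N + 1 + 1 / 3) (by push_cast; ring)
      have e2 := key' (3 * N + 2) (N + 1 - 1 / 3) (by push_cast; ring)
      rw [cotTerm, show w - 1 / 3 - (N + 1) = w - (N + 1 + 1 / 3) by ring,
        show w - 1 / 3 + (N + 1) = w + (N + 1 - 1 / 3) by ring, e1, e2]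
      ring
    have h2 : cotTerm (w + 1 / 3) N = 3 * (1 / ((3 * N + 4 : ℕ) + 3 * w)) -
        3 * (1 / ((3 * N + 2 : ℕ) - 3 * w)) := by
      have e1 := key' (3 * N + 4) (N + 1 + 1 / 3) (by push_cast; ring)
      have e2 := key (3 * N + 2) (N + 1 - 1 / 3) (by push_cast; ring)
      rw [cotTerm, show w + 1 / 3 - (N + 1) = w - (N + 1 - 1 / 3) by ring,
        show w + 1 / 3 + (N + 1) = w + (N + 1 + 1 / 3) by ring, e1, e2]
      ring
    rw [h1, h2]
    have h3 := hP (3 * N + 2)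
    have h4 : P (3 * (N + 1) + 1) = _ := hP (3 * N + 4)
    rw [h4]
    linear_combination ih - 3 * h3

theorem tsum_pow_sub_pow_eq {w : ℂ} (hw : 0 < w.im) {P : ℕ → ℂ}
    (hP : ∀ d : ℕ, P d = 1 / (d - 3 * w) + 1 / (d + 3 * w))
    (hs : Summable fun n : ℕ ↦ P (3 * n + 1) - P (3 * n + 2)) :
    ∑' k : ℕ, (exp (2 * π * I * w) ^ (3 * k + 1) - exp (2 * π * I * w) ^ (3 * k + 2)) =
      Real.sqrt 3 / (2 * π) * ∑' n : ℕ, (P (3 * n + 1) - P (3 * n + 2)) := by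
  have hw1 : 0 < (w - 1 / 3).im := by simpa using hw
  have hw2 : 0 < (w + 1 / 3).im := by simpa using hw
  have hcot : π * cot (π * (w - 1 / 3)) - π * cot (π * (w + 1 / 3)) =
      -3 * ∑' n : ℕ, (P (3 * n + 1) - P (3 * n + 2)) := by
    have t1 := tendsto_logDeriv_euler_cot_sub
      (UpperHalfPlane.coe_mem_integerComplement ⟨w - 1 / 3, hw1⟩)
    have t2 := tendsto_logDeriv_euler_cot_sub
      (UpperHalfPlane.coe_mem_integerComplement ⟨w + 1 / 3, hw2⟩)
    have t3 := (t1.add_const (1 / (w - 1 / 3))).sub (t2.add_const (1 / (w + 1 / 3)))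
    simp only [sum_cotTerm_sub_cotTerm hP, sub_add_cancel] at t3
    have t4 := (hs.hasSum.tendsto_sum_nat.const_mul (-3)).sub
      ((((tendsto_one_div_three_mul_add (1 - 3 * w)).add
        (tendsto_one_div_three_mul_add (1 + 3 * w))).const_mul 3))
    rw [add_zero, mul_zero, sub_zero] at t4
    refine tendsto_nhds_unique t3 (t4.congr fun N ↦ ?_)
    rw [hP (3 * N + 1)]
    push_cast
    simp only [add_sub_assoc, add_assoc]
  have hq := norm_exp_two_pi_I_mul_lt_one hw
  have c1 := pi_mul_cot_pi_q_exp ⟨w - 1 / 3, hw1⟩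
  have c2 := pi_mul_cot_pi_q_exp ⟨w + 1 / 3, hw2⟩
  have q1 := norm_exp_two_pi_I_mul_lt_one hw1
  have q2 := norm_exp_two_pi_I_mul_lt_one hw2
  rw [tsum_geometric_of_norm_lt_one q1] at c1
  rw [tsum_geometric_of_norm_lt_one q2] at c2
  have n1 : 1 - exp (2 * π * I * (w - 1 / 3)) ≠ 0 := by
    intro h; rw [← sub_eq_zero.mp h] at q1; simp at q1
  have n2 : 1 - exp (2 * π * I * (w + 1 / 3)) ≠ 0 := by
    intro h; rw [← sub_eq_zero.mp h] at q2; simp at q2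
  simp only [] at c1 c2
  rw [c1, c2] at hcot
  rw [mul_sub, exp_sub, exp_two_pi_I_div_three] at n1 hcot
  rw [mul_add, exp_add, exp_two_pi_I_div_three] at n2 hcot
  set q := exp (2 * π * I * w)
  have q3 : ‖q ^ 3‖ < 1 := by rw [norm_pow]; exact pow_lt_one₀ (norm_nonneg _) hq (by norm_num)
  have hg : ∑' k : ℕ, (q ^ (3 * k + 1) - q ^ (3 * k + 2)) = (q - q ^ 2) * (1 - q ^ 3)⁻¹ := by
    rw [← tsum_geometric_of_norm_lt_one q3, ← tsum_mul_left]
    refine tsum_congr fun k ↦ ?_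
    rw [← pow_mul]
    ring
  have hs3 : (Real.sqrt 3 : ℂ) ^ 2 = 3 := by
    rw [← ofReal_pow, Real.sq_sqrt (by norm_num)]; norm_num
  have hinv : q / (-1 / 2 + Real.sqrt 3 / 2 * I) = q * (-1 / 2 - Real.sqrt 3 / 2 * I) := by
    have h1 : (-1 / 2 + Real.sqrt 3 / 2 * I) * (-1 / 2 - Real.sqrt 3 / 2 * I) = 1 := by
      linear_combination -(Real.sqrt 3 : ℂ) ^ 2 / 4 * I_sq + hs3 / 4
    rw [div_eq_mul_inv, inv_eq_of_mul_eq_one_right h1]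
  rw [hinv] at n1 hcot
  have hprod : (1 - q * (-1 / 2 - Real.sqrt 3 / 2 * I)) *
      (1 - q * (-1 / 2 + Real.sqrt 3 / 2 * I)) = 1 + q + q ^ 2 := by
    linear_combination -q ^ 2 * (Real.sqrt 3 : ℂ) ^ 2 / 4 * I_sq + q ^ 2 * hs3 / 4
  have hsub : (1 - q * (-1 / 2 - Real.sqrt 3 / 2 * I))⁻¹ -
      (1 - q * (-1 / 2 + Real.sqrt 3 / 2 * I))⁻¹ = -(Real.sqrt 3 * I) * q / (1 + q + q ^ 2) := by
    rw [inv_sub_inv n1 n2, hprod]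
    ring
  have n4 : 1 + q + q ^ 2 ≠ 0 := hprod ▸ mul_ne_zero n1 n2
  have n5 : 1 - q ≠ 0 := by
    intro h; rw [← sub_eq_zero.mp h] at hq; simp at hq
  have hπ : (π : ℂ) ≠ 0 := by exact_mod_cast Real.pi_ne_zero
  have hsum : ∑' n : ℕ, (P (3 * n + 1) - P (3 * n + 2)) =
      2 * π * Real.sqrt 3 / 3 * (q / (1 + q + q ^ 2)) := by
    linear_combination (1 / 3) * hcot + (2 * π * I / 3) * hsub -
      2 * π * Real.sqrt 3 / 3 * (q / (1 + q + q ^ 2)) * I_sq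
  have hlhs : (q - q ^ 2) * (1 - q ^ 3)⁻¹ = q / (1 + q + q ^ 2) := by
    rw [show 1 - q ^ 3 = (1 - q) * (1 + q + q ^ 2) by ring]
    field_simp
  rw [hg, hsum, hlhs]
  field_simp
  linear_combination -q * hs3

theorem mem_slitPlane_of_im_pos {y : ℂ} (hy : 0 < y.im) : y ∈ slitPlane :=
  mem_slitPlane_iff.mpr (.inr hy.ne')

theorem neg_mem_slitPlane_of_im_pos {y : ℂ} (hy : 0 < y.im) : -y ∈ slitPlane :=
  mem_slitPlane_iff.mpr (.inr (by simpa using hy.ne'))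

theorem finf_eq_pairTerm {y : ℂ} (hy : 0 < y.im) :
    finf y = 3 * Real.sqrt 3 / (2 * π) * (∑' p, pairTerm (-y) p + ∑' p, pairTerm y p) := by
  have s1 := summable_pairTerm (neg_mem_slitPlane_of_im_pos hy)
  have s2 := summable_pairTerm (mem_slitPlane_of_im_pos hy)
  rw [finf_eq_tsum_pairs hy, ← s1.tsum_add s2, (s1.add s2).tsum_prod, ← tsum_mul_left,
    ← tsum_mul_left]
  refine tsum_congr fun m ↦ ?_
  have hm : (m : ℂ) + 1 ≠ 0 := by exact_mod_cast m.succ_ne_zero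
  have hP (k : ℕ) : (fun d : ℕ ↦ 1 / ((d : ℂ) - 3 * ((m + 1) * y)) + 1 / (d + 3 * ((m + 1) * y)))
      (3 * k + 1) - (fun d : ℕ ↦ 1 / ((d : ℂ) - 3 * ((m + 1) * y)) + 1 / (d + 3 * ((m + 1) * y)))
      (3 * k + 2) = (m + 1) * (pairTerm (-y) (m, k) + pairTerm y (m, k)) := by
    simp only [pairTerm, one_div]
    rw [← mul_add, mul_inv_cancel_left₀ hm]
    push_cast
    ring_nf
  have hyim : 0 < ((m + 1) * y).im := by
    have : ((m + 1) * y).im = (m + 1) * y.im := by simp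
    rw [this]
    positivity
  rw [tsum_pow_sub_pow_eq hyim (fun d ↦ rfl)]
  · simp only [hP]
    rw [tsum_mul_left]
    field_simp
  · simp only [hP]
    exact ((s1.add s2).prod_factor m).mul_left _

theorem summable_pairs {D : ℕ → ℂ} (hD : ∀ k, ‖D k‖ ≤ 1 / ((k : ℝ) + 1) ^ 2) : Summable D := by
  refine Summable.of_norm_bounded ?_ hD
  have := (summable_nat_add_iff 1).mpr (Real.summable_one_div_nat_pow.mpr one_lt_two)
  simpa using this

theorem summable_inv_pairs :
    Summable fun k : ℕ ↦ 1 / (3 * (k : ℂ) + 1) - 1 / (3 * (k : ℂ) + 2) := by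
  refine summable_pairs fun k ↦ ?_
  have h : 1 / (3 * (k : ℂ) + 1) - 1 / (3 * (k : ℂ) + 2) =
      ((1 / ((3 * k + 1) * (3 * k + 2)) : ℝ) : ℂ) := by
    have h1 : 3 * (k : ℂ) + 1 ≠ 0 := by exact_mod_cast (3 * k).succ_ne_zero
    have h2 : 3 * (k : ℂ) + 2 ≠ 0 := by exact_mod_cast (3 * k + 1).succ_ne_zero
    push_cast
    field_simp
    ring
  rw [h, norm_real, Real.norm_of_nonneg (by positivity)]
  gcongr
  nlinarith [(Nat.cast_nonneg k : (0 : ℝ) ≤ k)]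

theorem summable_inv_sq_pairs :
    Summable fun k : ℕ ↦ 1 / (3 * (k : ℂ) + 1) ^ 2 - 1 / (3 * (k : ℂ) + 2) ^ 2 := by
  have h (a : ℕ) (ha : 1 ≤ a) : Summable fun k : ℕ ↦ 1 / (3 * (k : ℂ) + a) ^ 2 := by
    refine summable_pairs fun k ↦ ?_
    have h : 1 / (3 * (k : ℂ) + a) ^ 2 = ((1 / (3 * k + a) ^ 2 : ℝ) : ℂ) := by
      push_cast
      rfl
    rw [h, norm_real, Real.norm_of_nonneg (by positivity)]
    have : (1 : ℝ) ≤ a := by exact_mod_cast ha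
    gcongr
    linarith [(Nat.cast_nonneg k : (0 : ℝ) ≤ k)]
  simpa using (h 1 le_rfl).sub (h 2 one_le_two)

theorem f0_neg_inv_eq_pairTerm {y : ℂ} (hy : 0 < y.im) :
    f0 (-1 / (3 * y)) =
      3 * Real.sqrt 3 / (2 * π) * (∑' p, pairTerm (-y) p - ∑' p, pairTerm y p) -
      3 * Real.sqrt 3 * I / 2 * (∑' k : ℕ, (1 / (3 * (k : ℂ) + 1) - 1 / (3 * (k : ℂ) + 2))) +
      9 * Real.sqrt 3 / (2 * π) *
        (∑' k : ℕ, (1 / (3 * (k : ℂ) + 1) ^ 2 - 1 / (3 * (k : ℂ) + 2) ^ 2)) * y := by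
  have s1 := summable_pairTerm (neg_mem_slitPlane_of_im_pos hy)
  have s2 := summable_pairTerm (mem_slitPlane_of_im_pos hy)
  have hy0 : y ≠ 0 := by rintro rfl; simp at hy
  have hz : 0 < (-1 / (3 * y)).im := by
    have h : (-1 / (3 * y)).im = y.im / (3 * normSq y) := by
      rw [show -1 / (3 * y) = ((1 / 3 : ℝ) : ℂ) * (-y⁻¹) by push_cast; field_simp, im_ofReal_mul,
        neg_im, inv_im]
      ring
    rw [h]
    have := normSq_pos.mpr hy0
    positivity
  have hdz (d : ℕ) (hd : 0 < d) : 0 < (d * (-1 / (3 * y))).im := by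
    have : (d * (-1 / (3 * y))).im = d * (-1 / (3 * y)).im := by simp
    rw [this]
    positivity
  set U : ℕ → ℕ → ℂ := fun d n ↦
    1 / ((n : ℂ) + 1) * (1 / (d + 3 * (n + 1) * -y) - 1 / (d + 3 * (n + 1) * y)) with hU
  have hne (d n : ℕ) (hd : 0 < d) {v : ℂ} (hv : v ∈ slitPlane) : d + 3 * (n + 1) * v ≠ 0 := by
    have := add_mul_ne_zero_of_mem_slitPlane hv (s := d) (t := 3 * (n + 1)) (by positivity)
      (by positivity)
    exact_mod_cast this
  have hUcot (d : ℕ) (hd : 0 < d) (n : ℕ) :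
      U d n = -(1 / d) * cotTerm (d * (-1 / (3 * y))) n := by
    have h1 := hne d n hd (neg_mem_slitPlane_of_im_pos hy)
    have h2 := hne d n hd (mem_slitPlane_of_im_pos hy)
    have hn : (n : ℂ) + 1 ≠ 0 := by exact_mod_cast n.succ_ne_zero
    have hd' : (d : ℂ) ≠ 0 := by exact_mod_cast hd.ne'
    have e1 : d * (-1 / (3 * y)) - (n + 1) = -(d + 3 * (n + 1) * y) / (3 * y) := by
      field_simp
      ring
    have e2 : d * (-1 / (3 * y)) + (n + 1) = -(d + 3 * (n + 1) * -y) / (3 * y) := by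
      field_simp
      ring
    rw [hU, cotTerm, e1, e2]
    simp only [one_div_div]
    generalize hA : d + 3 * (n + 1) * -y = A at *
    generalize hB : d + 3 * (n + 1) * y = B at *
    have hy' : y * (6 * (n + 1)) = B - A := by rw [← hA, ← hB]; ring
    have hd2 : (2 * d : ℂ) = A + B := by rw [← hA, ← hB]; ring
    field_simp
    linear_combination (-(d : ℂ)) * hy' + (3 * y * (n + 1)) * hd2
  have hUs (d : ℕ) (hd : 0 < d) : Summable (U d) := by
    simp only [funext (hUcot d hd)]
    exact (summable_cotTerm
      (UpperHalfPlane.coe_mem_integerComplement ⟨_, hdz d hd⟩)).mul_left _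
  rw [f0_eq_tsum_pairs hz (H := fun d ↦ -1 / 2 * (1 / (d : ℂ)) -
    3 * I * y / (2 * π) * (1 / (d : ℂ) ^ 2) - I / (2 * π) * ∑' n, U d n)]
  · have hk (k : ℕ) : ∑' n, U (3 * k + 1) n - ∑' n, U (3 * k + 2) n =
        ∑' n, (pairTerm (-y) (n, k) - pairTerm y (n, k)) := by
      rw [← (hUs _ (by positivity)).tsum_sub (hUs _ (by positivity))]
      refine tsum_congr fun n ↦ ?_
      simp only [hU, pairTerm]
      push_cast
      ring
    have s3 := s1.sub s2
    have s4 : Summable fun k : ℕ ↦ ∑' n, (pairTerm (-y) (n, k) - pairTerm y (n, k)) :=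
      s3.prod_symm.prod
    have hs4 : ∑' k : ℕ, ∑' n, (pairTerm (-y) (n, k) - pairTerm y (n, k)) =
        ∑' p, pairTerm (-y) p - ∑' p, pairTerm y p := by
      rw [← s1.tsum_sub s2, s3.tsum_prod]
      exact Summable.tsum_comm (f := fun n k ↦ pairTerm (-y) (n, k) - pairTerm y (n, k)) s3
    have htot := ((summable_inv_pairs.hasSum.mul_left (-1 / 2)).sub
      (summable_inv_sq_pairs.hasSum.mul_left (3 * I * y / (2 * π)))).sub
      (s4.hasSum.mul_left (I / (2 * π)))
    rw [hs4] at htot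
    rw [tsum_congr fun k ↦ ?_, htot.tsum_eq]
    · linear_combination (-9 * Real.sqrt 3 / (2 * π) *
        (∑' k : ℕ, (1 / (3 * (k : ℂ) + 1) ^ 2 - 1 / (3 * (k : ℂ) + 2) ^ 2)) * y -
        3 * Real.sqrt 3 / (2 * π) * (∑' p, pairTerm (-y) p - ∑' p, pairTerm y p)) * I_sq
    · rw [← hk]
      push_cast
      ring
  · intro d
    have hd := d.pos
    have hd' : ((d : ℕ) : ℂ) ≠ 0 := by exact_mod_cast hd.ne'
    have hpow (m : ℕ+) : exp (2 * π * I * (-1 / (3 * y))) ^ (d * m : ℕ) =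
        exp (2 * π * I * (d * (-1 / (3 * y)))) ^ (m : ℕ) := by
      rw [pow_mul, ← exp_nat_mul]
      ring_nf
    simp only [hpow]
    rw [tsum_pow_eq_cot (hdz d hd)]
    simp only [hUcot d hd]
    rw [tsum_mul_left]
    field_simp
    ring

/-- `F_S(y) = f_∞(y) − f₀(−1/(3y))` extends holomorphically to the cut plane
`ℂ ∖ ℝ_{≤0} = Complex.slitPlane`. -/
theorem stmt15 :
    ∃ G : ℂ → ℂ, DifferentiableOn ℂ G Complex.slitPlane ∧
      ∀ y : ℂ, 0 < y.im → G y = finf y - f0 (-1 / (3 * y)) := by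
  refine ⟨fun y ↦ 3 * Real.sqrt 3 / π * ∑' p, pairTerm y p +
      3 * Real.sqrt 3 * I / 2 * (∑' k : ℕ, (1 / (3 * (k : ℂ) + 1) - 1 / (3 * (k : ℂ) + 2))) -
      9 * Real.sqrt 3 / (2 * π) *
        (∑' k : ℕ, (1 / (3 * (k : ℂ) + 1) ^ 2 - 1 / (3 * (k : ℂ) + 2) ^ 2)) * y,
    ((differentiableOn_tsum_pairTerm.const_mul _).add_const _).sub
      (differentiableOn_id.const_mul _), fun y hy ↦ ?_⟩
  rw [finf_eq_pairTerm hy, f0_neg_inv_eq_pairTerm hy]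
  ring
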